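/- (Strichartz-type bound, operator form) Let d ≥ 3 and V ∈ L^{d/2,∞}(ℝ^d). Then the operator f ↦ |V|^{1/2} (−Δ)^{-1/2} f is bounded on L²(ℝ^d), with operator norm ‖ |V|^{1/2} (−Δ)^{-1/2} ‖_{2→2} ≤ C_d ‖V‖_{d/2,∞}^{1/2} for a dimensional constant C_d. -/

import Mathlib

open MeasureTheory Real ENNReal

theorem sum_two_zpow_filter_le (s : Finset ℤ) (i : ℤ) :
    ∑ j ∈ s.filter (· ≤ i), (2 : ℝ≥0∞) ^ j ≤ 2 * 2 ^ i := by
  classical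
  have hinj : Set.InjOn (fun j : ℤ => (i - j).toNat) (s.filter (· ≤ i) : Finset ℤ) := by
    intro a ha b hb hab
    simp only [Finset.coe_filter, Set.mem_ofPred_eq] at ha hb hab
    omega
  have h2 : (2 : ℝ≥0∞) ≠ 0 := by norm_num
  have h2' : (2 : ℝ≥0∞) ≠ ∞ := by norm_num
  calc ∑ j ∈ s.filter (· ≤ i), (2 : ℝ≥0∞) ^ j
      = ∑ j ∈ s.filter (· ≤ i), 2 ^ i * (2⁻¹ : ℝ≥0∞) ^ (i - j).toNat := by
        refine Finset.sum_congr rfl fun j hj => ?_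
        have hj' : j ≤ i := (Finset.mem_filter.1 hj).2
        have : j = i + -((i - j).toNat : ℤ) := by omega
        conv_lhs => rw [this]
        rw [ENNReal.zpow_add h2 h2', ENNReal.zpow_neg, zpow_natCast, ENNReal.inv_pow]
    _ = 2 ^ i * ∑ n ∈ (s.filter (· ≤ i)).image (fun j => (i - j).toNat), (2⁻¹ : ℝ≥0∞) ^ n := by
        rw [Finset.sum_image hinj, Finset.mul_sum]
    _ ≤ 2 ^ i * ∑' n : ℕ, (2⁻¹ : ℝ≥0∞) ^ n := by
        gcongr
        exact ENNReal.sum_le_tsum _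
    _ = 2 * 2 ^ i := by rw [ENNReal.tsum_geometric_two, mul_comm]

theorem sum_sum_two_zpow_le (s : Finset ℤ) (a : ℤ → ℝ≥0∞) (T : ℤ → ℤ → ℝ≥0∞)
    (hle : ∀ i j, j ≤ i → T i j ≤ 2 ^ i * 2 ^ j * a i) (hsymm : ∀ i j, T i j = T j i) :
    ∑ i ∈ s, ∑ j ∈ s, T i j ≤ 4 * ∑ i ∈ s, 2 ^ i * 2 ^ i * a i := by
  classical
  have key : ∑ i ∈ s, ∑ j ∈ s.filter (· ≤ i), T i j ≤ 2 * ∑ i ∈ s, 2 ^ i * 2 ^ i * a i := by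
    rw [Finset.mul_sum]
    refine Finset.sum_le_sum fun i _ => ?_
    calc ∑ j ∈ s.filter (· ≤ i), T i j
        ≤ ∑ j ∈ s.filter (· ≤ i), 2 ^ i * a i * 2 ^ j := by
          refine Finset.sum_le_sum fun j hj => (hle i j (Finset.mem_filter.1 hj).2).trans_eq ?_
          ring
      _ = 2 ^ i * a i * ∑ j ∈ s.filter (· ≤ i), 2 ^ j := by rw [Finset.mul_sum]
      _ ≤ 2 ^ i * a i * (2 * 2 ^ i) := by gcongr; exact sum_two_zpow_filter_le s i
      _ = 2 * (2 ^ i * 2 ^ i * a i) := by ring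
  have key2 : ∑ i ∈ s, ∑ j ∈ s.filter (fun j => ¬ j ≤ i), T i j
      ≤ ∑ i ∈ s, ∑ j ∈ s.filter (· ≤ i), T i j := by
    simp only [Finset.sum_filter]
    rw [Finset.sum_comm]
    refine Finset.sum_le_sum fun i _ => Finset.sum_le_sum fun j _ => ?_
    rw [hsymm j i]
    split_ifs <;> first | omega | simp
  calc ∑ i ∈ s, ∑ j ∈ s, T i j
      = ∑ i ∈ s, ∑ j ∈ s.filter (· ≤ i), T i j
        + ∑ i ∈ s, ∑ j ∈ s.filter (fun j => ¬ j ≤ i), T i j := by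
        rw [← Finset.sum_add_distrib]
        exact Finset.sum_congr rfl fun i _ => (Finset.sum_filter_add_sum_filter_not s _ _).symm
    _ ≤ 2 * ∑ i ∈ s, 2 ^ i * 2 ^ i * a i + 2 * ∑ i ∈ s, 2 ^ i * 2 ^ i * a i :=
        add_le_add key (key2.trans key)
    _ = 4 * ∑ i ∈ s, 2 ^ i * 2 ^ i * a i := by ring

section Kernel

variable {X : Type*} [MeasurableSpace X] {μ : Measure X} [SFinite μ] {k : X → X → ℝ≥0∞}

theorem lintegral_mul_potential (hk : Measurable (Function.uncurry k))
    (hsymm : ∀ x y, k x y = k y x) {f : X → ℝ≥0∞} (hf : Measurable f)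
    (A : Set X) :
    ∫⁻ x in A, ∫⁻ y, k x y * f y ∂μ ∂μ = ∫⁻ y, f y * ∫⁻ x in A, k y x ∂μ ∂μ := by
  rw [lintegral_lintegral_swap]
  · refine lintegral_congr fun y => ?_
    have : Measurable fun x => k y x := hk.comp (measurable_const.prodMk measurable_id)
    rw [← lintegral_const_mul _ this]
    refine lintegral_congr fun x => ?_
    rw [hsymm x y, mul_comm]
  · exact (hk.mul (hf.comp measurable_snd)).aemeasurable

theorem measurable_potential_set (hk : Measurable (Function.uncurry k)) (A : Set X) :
    Measurable fun y => ∫⁻ x in A, k y x ∂μ :=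
  Measurable.lintegral_prod_right hk

theorem lintegral_potential_mul_potential_le (hk : Measurable (Function.uncurry k))
    (hsymm : ∀ x y, k x y = k y x) {K : ℝ≥0∞} {A B : Set X}
    (hB : ∀ x, ∫⁻ z in B, ∫⁻ y, k x y * k y z ∂μ ∂μ ≤ K) :
    ∫⁻ y, (∫⁻ x in A, k y x ∂μ) * (∫⁻ z in B, k y z ∂μ) ∂μ ≤ K * μ A := by
  have hu := measurable_potential_set (μ := μ) hk B
  calc ∫⁻ y, (∫⁻ x in A, k y x ∂μ) * (∫⁻ z in B, k y z ∂μ) ∂μ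
      = ∫⁻ x in A, ∫⁻ y, k x y * (∫⁻ z in B, k y z ∂μ) ∂μ ∂μ := by
        rw [lintegral_mul_potential hk hsymm hu A]
        exact lintegral_congr fun y => mul_comm _ _
    _ = ∫⁻ x in A, ∫⁻ z in B, ∫⁻ y, k x y * k y z ∂μ ∂μ ∂μ := by
        refine lintegral_congr fun x => ?_
        rw [lintegral_lintegral_swap]
        · refine lintegral_congr fun y => ?_
          rw [lintegral_const_mul]
          exact hk.comp (measurable_const.prodMk measurable_id)
        · refine Measurable.aemeasurable ?_
          refine Measurable.mul ?_ ?_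
          · exact hk.comp (measurable_const.prodMk measurable_snd)
          · exact hk.comp (measurable_snd.prodMk measurable_fst)
    _ ≤ ∫⁻ x in A, K ∂μ := lintegral_mono fun x => hB x
    _ = K * μ A := by simp

theorem sum_four_zpow_mul_measure_rpow_le (hk : Measurable (Function.uncurry k))
    (hsymm : ∀ x y, k x y = k y x) {α : ℝ} (hα1 : α < 1) {K : ℝ≥0∞}
    (hK : ∀ B : Set X, MeasurableSet B →
      ∀ x, ∫⁻ z in B, ∫⁻ y, k x y * k y z ∂μ ∂μ ≤ K * μ B ^ α)
    {f : X → ℝ≥0∞} (hf : Measurable f) {E : ℤ → Set X}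
    (hEm : ∀ j, MeasurableSet (E j)) (hEfin : ∀ j, μ (E j) ≠ ∞)
    (hEf : ∀ j, ∀ x ∈ E j, 2 ^ j ≤ ∫⁻ y, k x y * f y ∂μ) (s : Finset ℤ) :
    ∑ j ∈ s, 2 ^ j * 2 ^ j * μ (E j) ^ (1 - α) ≤ 4 * K * ∫⁻ x, f x ^ (2 : ℝ) ∂μ := by
  set S := ∑ j ∈ s, (2 : ℝ≥0∞) ^ j * 2 ^ j * μ (E j) ^ (1 - α) with hS
  set F := ∫⁻ x, f x ^ (2 : ℝ) ∂μ with hF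
  have h2 : (2 : ℝ≥0∞) ≠ 0 := by norm_num
  have h2' : (2 : ℝ≥0∞) ≠ ∞ := by norm_num
  have hSfin : S ≠ ∞ := by
    refine ENNReal.sum_ne_top.2 fun j _ => ?_
    have := ENNReal.zpow_ne_top h2 h2' j
    exact ENNReal.mul_ne_top (ENNReal.mul_ne_top this this)
      (ENNReal.rpow_ne_top_of_nonneg (by linarith) (hEfin j))
  let c : ℤ → ℝ≥0∞ := fun j => 2 ^ j * (μ (E j) ^ α)⁻¹
  let u : ℤ → X → ℝ≥0∞ := fun j y => ∫⁻ x in E j, k y x ∂μ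
  have hu : ∀ j, Measurable (u j) := fun j => measurable_potential_set hk (E j)
  let U : X → ℝ≥0∞ := fun y => ∑ j ∈ s, c j * u j y
  have hU : Measurable U := Finset.measurable_fun_sum s fun j _ => (hu j).const_mul _
  have hquot : ∀ j, (μ (E j) ^ α)⁻¹ * μ (E j) = μ (E j) ^ (1 - α) := by
    intro j
    rcases eq_or_ne (μ (E j)) 0 with h0 | h0
    · rw [h0, mul_zero, ENNReal.zero_rpow_of_pos (by linarith)]
    · rw [sub_eq_neg_add, ENNReal.rpow_add _ _ h0 (hEfin j), ENNReal.rpow_one, ENNReal.rpow_neg]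
  have hlow : S ≤ ∫⁻ y, (f * U) y ∂μ := by
    have : ∫⁻ y, (f * U) y ∂μ = ∑ j ∈ s, c j * ∫⁻ y, f y * u j y ∂μ := by
      simp only [Pi.mul_apply, U, Finset.mul_sum]
      rw [lintegral_finsetSum]
      · refine Finset.sum_congr rfl fun j _ => ?_
        rw [← lintegral_const_mul (f := fun y => f y * u j y) _ (hf.mul (hu j))]
        exact lintegral_congr fun y => by ring
      · exact fun j _ => hf.mul ((hu j).const_mul _)
    rw [this]
    refine Finset.sum_le_sum fun j _ => ?_
    have hj : 2 ^ j * μ (E j) ≤ ∫⁻ y, f y * u j y ∂μ := by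
      rw [← lintegral_mul_potential hk hsymm hf (E j), ← setLIntegral_const]
      exact setLIntegral_mono' (hEm j) (hEf j)
    calc (2 : ℝ≥0∞) ^ j * 2 ^ j * μ (E j) ^ (1 - α) = c j * (2 ^ j * μ (E j)) := by
          rw [← hquot j]; simp only [c]; ring
      _ ≤ _ := by gcongr
  have hup : ∫⁻ y, U y ^ (2 : ℝ) ∂μ ≤ 4 * K * S := by
    have : ∫⁻ y, U y ^ (2 : ℝ) ∂μ
        = ∑ i ∈ s, ∑ j ∈ s, c i * c j * ∫⁻ y, u i y * u j y ∂μ := by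
      have h1 : ∀ y, U y ^ (2 : ℝ) = ∑ i ∈ s, ∑ j ∈ s, c i * c j * (u i y * u j y) := by
        intro y
        rw [ENNReal.rpow_two, sq, Finset.sum_mul_sum]
        exact Finset.sum_congr rfl fun i _ => Finset.sum_congr rfl fun j _ => by ring
      simp only [h1]
      rw [lintegral_finsetSum]
      · refine Finset.sum_congr rfl fun i _ => ?_
        rw [lintegral_finsetSum]
        · exact Finset.sum_congr rfl fun j _ => lintegral_const_mul _ ((hu i).mul (hu j))
        · exact fun j _ => ((hu i).mul (hu j)).const_mul _
      · exact fun i _ => Finset.measurable_fun_sum s fun j _ => ((hu i).mul (hu j)).const_mul _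
    rw [this]
    refine (sum_sum_two_zpow_le s (fun i => K * μ (E i) ^ (1 - α)) _ ?_ ?_).trans_eq ?_
    · intro i j _
      have hp : ∫⁻ y, u i y * u j y ∂μ ≤ K * μ (E j) ^ α * μ (E i) :=
        lintegral_potential_mul_potential_le hk hsymm (hK (E j) (hEm j))
      calc c i * c j * ∫⁻ y, u i y * u j y ∂μ
          ≤ c i * c j * (K * μ (E j) ^ α * μ (E i)) := by gcongr
        _ = 2 ^ i * 2 ^ j * (K * ((μ (E i) ^ α)⁻¹ * μ (E i)))
            * ((μ (E j) ^ α)⁻¹ * μ (E j) ^ α) := by simp only [c]; ring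
        _ ≤ 2 ^ i * 2 ^ j * (K * ((μ (E i) ^ α)⁻¹ * μ (E i))) * 1 := by
          gcongr
          exact ENNReal.inv_mul_le_one _
        _ = _ := by rw [hquot i, mul_one]
    · intro i j
      rw [mul_comm (c i) (c j)]
      congr 1
      exact lintegral_congr fun y => mul_comm _ _
    · rw [hS, Finset.mul_sum, Finset.mul_sum]
      exact Finset.sum_congr rfl fun i _ => by ring
  have hCS := ENNReal.lintegral_mul_le_Lp_mul_Lq μ Real.HolderConjugate.two_two
    hf.aemeasurable hU.aemeasurable
  have hsq : S * S ≤ 4 * K * F * S := by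
    have h1 : S ≤ F ^ ((1 : ℝ) / 2) * (4 * K * S) ^ ((1 : ℝ) / 2) := by
      refine hlow.trans (hCS.trans ?_)
      gcongr
    rw [← ENNReal.mul_rpow_of_nonneg _ _ (by norm_num)] at h1
    have h3 := ENNReal.rpow_le_rpow h1 (by norm_num : (0 : ℝ) ≤ 2)
    rw [← ENNReal.rpow_mul, ENNReal.rpow_two, sq] at h3
    norm_num at h3
    calc S * S ≤ _ := h3
      _ = _ := by ring
  rcases eq_or_ne S 0 with h0 | h0
  · rw [h0]; exact zero_le
  · exact (ENNReal.mul_le_mul_iff_left h0 hSfin).1 hsq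

end Kernel

theorem setLIntegral_ofReal_le_of_weak_bound {X : Type*} [MeasurableSpace X] {μ : Measure X}
    {W : X → ℝ} (hW : Measurable W) (hW0 : ∀ x, 0 ≤ W x) {α : ℝ} (hα0 : 0 < α) (hα1 : α < 1)
    {M : ℝ} (hM : 0 ≤ M)
    (h : ∀ l : ℝ, 0 < l → ENNReal.ofReal l * μ {x | l < W x} ^ α ≤ ENNReal.ofReal M)
    {A : Set X} (hA : μ A ≠ ∞) :
    ∫⁻ x in A, ENNReal.ofReal (W x) ∂μ ≤ ENNReal.ofReal (M / (1 - α)) * μ A ^ (1 - α) := by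
  rcases eq_or_ne (μ A) 0 with hA0 | hA0
  · rw [Measure.restrict_eq_zero.2 hA0]; simp
  rw [lintegral_eq_lintegral_meas_lt _ (Filter.Eventually.of_forall hW0) hW.aemeasurable]
  have hlevel : ∀ t : ℝ, 0 < t → μ {x | t < W x} ≤ ENNReal.ofReal (M ^ α⁻¹ * t ^ (-α⁻¹)) := by
    intro t ht
    have h1 : μ {x | t < W x} ^ α ≤ ENNReal.ofReal (M / t) := by
      rw [ENNReal.ofReal_div_of_pos ht, ENNReal.le_div_iff_mul_le (by simp [ht]) (by simp), mul_comm]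
      exact h t ht
    have h2 := ENNReal.rpow_le_rpow h1 (inv_pos.2 hα0).le
    rw [← ENNReal.rpow_mul, mul_inv_cancel₀ hα0.ne', ENNReal.rpow_one,
      ENNReal.ofReal_rpow_of_nonneg (by positivity) (inv_pos.2 hα0).le,
      Real.div_rpow hM ht.le] at h2
    rwa [Real.rpow_neg ht.le, ← div_eq_mul_inv]
  rcases hM.eq_or_lt with rfl | hMpos
  · refine le_trans ?_ zero_le
    rw [nonpos_iff_eq_zero, setLIntegral_eq_zero_iff measurableSet_Ioi]
    · refine Filter.Eventually.of_forall fun t ht => ?_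
      refine le_antisymm ((Measure.restrict_apply_le _ _).trans ((hlevel t ht).trans ?_)) zero_le
      rw [Real.zero_rpow (inv_pos.2 hα0).ne']
      simp
    · exact (Antitone.measurable fun a b hab => measure_mono fun x hx => lt_of_le_of_lt hab hx)
  set m := (μ A).toReal with hm
  have hmpos : 0 < m := ENNReal.toReal_pos hA0 hA
  have hmA : μ A = ENNReal.ofReal m := (ENNReal.ofReal_toReal hA).symm
  set t₀ := M * m ^ (-α) with ht₀
  have ht₀pos : 0 < t₀ := by positivity
  have hp : 1 < α⁻¹ := (one_lt_inv₀ hα0).2 hα1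
  have hlow : ∫⁻ t in Set.Ioc 0 t₀, (μ.restrict A) {x | t < W x} ≤ ENNReal.ofReal (m * t₀) := by
    calc ∫⁻ t in Set.Ioc 0 t₀, (μ.restrict A) {x | t < W x}
        ≤ ∫⁻ t in Set.Ioc 0 t₀, ENNReal.ofReal m := by
          refine lintegral_mono fun t => ?_
          rw [← hmA]
          exact (measure_mono (Set.subset_univ _)).trans_eq (by simp)
      _ = ENNReal.ofReal (m * t₀) := by
          rw [setLIntegral_const, Real.volume_Ioc, sub_zero, ENNReal.ofReal_mul hmpos.le]
  have hhigh : ∫⁻ t in Set.Ioi t₀, (μ.restrict A) {x | t < W x}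
      ≤ ENNReal.ofReal (M ^ α⁻¹ * (-t₀ ^ (-α⁻¹ + 1) / (-α⁻¹ + 1))) := by
    have hint := integrableOn_Ioi_rpow_of_lt (by linarith : -α⁻¹ < -1) ht₀pos
    rw [← integral_Ioi_rpow_of_lt (by linarith : -α⁻¹ < -1) ht₀pos, ← integral_const_mul,
      ofReal_integral_eq_lintegral_ofReal (hint.const_mul _)]
    · refine setLIntegral_mono' measurableSet_Ioi fun t ht => ?_
      exact (Measure.restrict_apply_le _ _).trans (hlevel t (ht₀pos.trans ht))
    · refine (ae_restrict_iff' measurableSet_Ioi).2 (Filter.Eventually.of_forall fun t ht => ?_)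
      have : 0 < t := ht₀pos.trans ht
      simp only [Pi.zero_apply]
      positivity
  have hvalue : m * t₀ + M ^ α⁻¹ * (-t₀ ^ (-α⁻¹ + 1) / (-α⁻¹ + 1)) = M / (1 - α) * m ^ (1 - α) := by
    have e1 : m * t₀ = M * m ^ (1 - α) := by
      rw [ht₀, sub_eq_add_neg, Real.rpow_add hmpos, Real.rpow_one]; ring
    have e2 : M ^ α⁻¹ * t₀ ^ (-α⁻¹ + 1) = M * m ^ (1 - α) := by
      rw [ht₀, Real.mul_rpow hMpos.le (by positivity), ← mul_assoc, ← Real.rpow_add hMpos,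
        ← Real.rpow_mul hmpos.le]
      congr 2
      · rw [add_neg_cancel_left, Real.rpow_one]
      · field_simp
        ring
    have e3 : M ^ α⁻¹ * (-t₀ ^ (-α⁻¹ + 1) / (-α⁻¹ + 1))
        = (M ^ α⁻¹ * t₀ ^ (-α⁻¹ + 1)) / (α⁻¹ - 1) := by
      rw [show -α⁻¹ + 1 = -(α⁻¹ - 1) by ring, neg_div_neg_eq, mul_div_assoc]
    rw [e3, e1, e2]
    have : 1 - α ≠ 0 := by linarith
    have : α⁻¹ - 1 ≠ 0 := by linarith
    have h4 : α⁻¹ - 1 = (1 - α) / α := by field_simp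
    rw [h4]
    field_simp
    ring
  calc ∫⁻ t in Set.Ioi 0, (μ.restrict A) {x | t < W x}
      ≤ (∫⁻ t in Set.Ioc 0 t₀, (μ.restrict A) {x | t < W x})
        + ∫⁻ t in Set.Ioi t₀, (μ.restrict A) {x | t < W x} := by
        rw [← Set.Ioc_union_Ioi_eq_Ioi ht₀pos.le]
        exact lintegral_union_le _ _ _
    _ ≤ ENNReal.ofReal (m * t₀) + ENNReal.ofReal (M ^ α⁻¹ * (-t₀ ^ (-α⁻¹ + 1) / (-α⁻¹ + 1))) :=
        add_le_add hlow hhigh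
    _ = ENNReal.ofReal (M / (1 - α)) * μ A ^ (1 - α) := by
        rw [← ENNReal.ofReal_add (by positivity), hvalue, ENNReal.ofReal_mul
          (div_nonneg hM (by linarith)), hmA, ENNReal.ofReal_rpow_of_pos hmpos]
        refine mul_nonneg (by positivity) (div_nonneg_of_nonpos ?_ (by linarith))
        rw [neg_nonpos]; positivity

theorem ENNReal.sq_le_four_mul_tsum_zpow (a : ℝ≥0∞) :
    a ^ 2 ≤ 4 * ∑' j : ℤ, if (2 : ℝ≥0∞) ^ j < a then (2 : ℝ≥0∞) ^ j * 2 ^ j else 0 := by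
  have h2 : (2 : ℝ≥0∞) ≠ 0 := by norm_num
  have h2' : (2 : ℝ≥0∞) ≠ ∞ := by norm_num
  rcases eq_or_ne a 0 with rfl | h0
  · simp
  rcases eq_or_ne a ∞ with rfl | htop
  · have hterm : ∀ n : ℕ, ((2 : ℝ≥0∞) ^ n)
        ≤ ∑' j : ℤ, if (2 : ℝ≥0∞) ^ j < ∞ then (2 : ℝ≥0∞) ^ j * 2 ^ j else 0 := by
      intro n
      refine le_trans ?_ (ENNReal.le_tsum (n : ℤ))
      rw [if_pos (ENNReal.zpow_lt_top h2 h2' _), zpow_natCast]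
      exact le_mul_of_one_le_left' (one_le_pow₀ (by norm_num))
    have : ∑' j : ℤ, (if (2 : ℝ≥0∞) ^ j < ∞ then (2 : ℝ≥0∞) ^ j * 2 ^ j else 0) = ∞ := by
      refine top_unique (le_of_tendsto'
        (ENNReal.tendsto_pow_atTop_nhds_top_iff.2 (by norm_num)) hterm)
    rw [this]
    simp
  · obtain ⟨j, hj1, hj2⟩ := ENNReal.exists_mem_Ioc_zpow h0 htop (by norm_num : (1 : ℝ≥0∞) < 2) h2'
    calc a ^ 2 ≤ ((2 : ℝ≥0∞) ^ (j + 1)) ^ 2 := by gcongr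
      _ = 4 * (2 ^ j * 2 ^ j) := by
        rw [ENNReal.zpow_add h2 h2', zpow_one]; ring
      _ ≤ _ := by
        gcongr
        refine le_trans ?_ (ENNReal.le_tsum j)
        rw [if_pos hj1]

theorem lintegral_weak_mul_potential_sq_le {X : Type*} [MeasurableSpace X] {μ : Measure X}
    [SigmaFinite μ] {k : X → X → ℝ≥0∞} (hk : Measurable (Function.uncurry k))
    (hsymm : ∀ x y, k x y = k y x) {α : ℝ} (hα0 : 0 < α) (hα1 : α < 1) {K : ℝ≥0∞}
    (hK : ∀ B : Set X, MeasurableSet B →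
      ∀ x, ∫⁻ z in B, ∫⁻ y, k x y * k y z ∂μ ∂μ ≤ K * μ B ^ α)
    {W : X → ℝ} (hW : Measurable W) (hW0 : ∀ x, 0 ≤ W x) {M : ℝ} (hM : 0 ≤ M)
    (h : ∀ l : ℝ, 0 < l → ENNReal.ofReal l * μ {x | l < W x} ^ α ≤ ENNReal.ofReal M)
    {f : X → ℝ≥0∞} (hf : Measurable f) :
    ∫⁻ x, ENNReal.ofReal (W x) * (∫⁻ y, k x y * f y ∂μ) ^ 2 ∂μ
      ≤ 16 * K * ENNReal.ofReal (M / (1 - α)) * ∫⁻ x, f x ^ (2 : ℝ) ∂μ := by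
  set g : X → ℝ≥0∞ := fun x => ∫⁻ y, k x y * f y ∂μ with hg
  have hgm : Measurable g :=
    Measurable.lintegral_prod_right (f := fun x y => k x y * f y)
      (hk.mul (hf.comp measurable_snd))
  have hWm : Measurable fun x => ENNReal.ofReal (W x) := hW.ennreal_ofReal
  rw [← setLIntegral_univ, ← iUnion_spanningSets μ,
    setLIntegral_iUnion_of_directed _ (monotone_spanningSets μ).directed_le]
  refine iSup_le fun n => ?_
  set B := spanningSets μ n with hB
  have hBm : MeasurableSet B := measurableSet_spanningSets μ n
  have hBfin : μ B ≠ ∞ := (measure_spanningSets_lt_top μ n).ne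
  let E : ℤ → Set X := fun j => B ∩ {x | (2 : ℝ≥0∞) ^ j < g x}
  have hlev : ∀ j : ℤ, MeasurableSet {x | (2 : ℝ≥0∞) ^ j < g x} :=
    fun j => measurableSet_lt measurable_const hgm
  have hEm : ∀ j, MeasurableSet (E j) := fun j => hBm.inter (hlev j)
  have hEfin : ∀ j, μ (E j) ≠ ∞ := fun j => measure_ne_top_of_subset Set.inter_subset_left hBfin
  set D := ENNReal.ofReal (M / (1 - α)) with hD
  set F := ∫⁻ x, f x ^ (2 : ℝ) ∂μ with hF
  calc ∫⁻ x in B, ENNReal.ofReal (W x) * g x ^ 2 ∂μ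
      ≤ ∫⁻ x in B, 4 * ∑' j : ℤ, 2 ^ j * 2 ^ j *
          Set.indicator {x | (2 : ℝ≥0∞) ^ j < g x} (fun x => ENNReal.ofReal (W x)) x ∂μ := by
        refine lintegral_mono fun x => ?_
        calc ENNReal.ofReal (W x) * g x ^ 2
            ≤ ENNReal.ofReal (W x) *
              (4 * ∑' j : ℤ, if (2 : ℝ≥0∞) ^ j < g x then (2 : ℝ≥0∞) ^ j * 2 ^ j else 0) := by
              gcongr
              exact ENNReal.sq_le_four_mul_tsum_zpow _
          _ = _ := by
              rw [mul_left_comm, ← ENNReal.tsum_mul_left]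
              congr 2
              ext j
              by_cases hj : (2 : ℝ≥0∞) ^ j < g x
              · simp [hj, mul_comm]
              · simp [hj]
    _ = 4 * ∑' j : ℤ, 2 ^ j * 2 ^ j * ∫⁻ x in E j, ENNReal.ofReal (W x) ∂μ := by
        have hind : ∀ j : ℤ, Measurable
            (Set.indicator {x | (2 : ℝ≥0∞) ^ j < g x} fun x => ENNReal.ofReal (W x)) :=
          fun j => hWm.indicator (hlev j)
        rw [lintegral_const_mul _ (Measurable.tsum fun j => (hind j).const_mul _),
          lintegral_tsum fun j => ((hind j).const_mul _).aemeasurable]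
        congr 2
        ext j
        rw [lintegral_const_mul _ (hind j), lintegral_indicator (hlev j),
          Measure.restrict_restrict (hlev j), Set.inter_comm]
    _ ≤ 4 * ∑' j : ℤ, D * (2 ^ j * 2 ^ j * μ (E j) ^ (1 - α)) := by
        gcongr 4 * ?_
        refine ENNReal.tsum_le_tsum fun j => ?_
        calc (2 : ℝ≥0∞) ^ j * 2 ^ j * ∫⁻ x in E j, ENNReal.ofReal (W x) ∂μ
            ≤ 2 ^ j * 2 ^ j * (D * μ (E j) ^ (1 - α)) := by
              gcongr
              exact setLIntegral_ofReal_le_of_weak_bound hW hW0 hα0 hα1 hM h (hEfin j)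
          _ = _ := by ring
    _ = 4 * (D * ⨆ s : Finset ℤ, ∑ j ∈ s, 2 ^ j * 2 ^ j * μ (E j) ^ (1 - α)) := by
        rw [ENNReal.tsum_mul_left, ENNReal.tsum_eq_iSup_sum]
    _ ≤ 4 * (D * (4 * K * F)) := by
        gcongr
        exact iSup_le fun s => sum_four_zpow_mul_measure_rpow_le hk hsymm hα1 hK hf hEm hEfin
          (fun j x hx => hx.2.le) s
    _ = 16 * K * D * F := by ring

theorem lintegral_ofReal_comp_norm {d : ℕ} (hd : 3 ≤ d) {φ ψ : ℝ → ℝ}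
    (hφ : ∀ r, 0 ≤ r → 0 ≤ φ r) (hψ : IntegrableOn ψ (Set.Ioi 0))
    (heq : ∀ r, 0 < r → r ^ (d - 1) * φ r = ψ r) :
    ∫⁻ x : EuclideanSpace ℝ (Fin d), ENNReal.ofReal (φ ‖x‖)
      = ENNReal.ofReal (d * volume.real (Metric.ball (0 : EuclideanSpace ℝ (Fin d)) 1)
          * ∫ r in Set.Ioi (0 : ℝ), ψ r) := by
  have : Nontrivial (EuclideanSpace ℝ (Fin d)) :=
    Module.nontrivial_of_finrank_pos (R := ℝ) (by rw [finrank_euclideanSpace_fin]; omega)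
  have hint : Integrable (fun x : EuclideanSpace ℝ (Fin d) => φ ‖x‖) := by
    rw [integrable_fun_norm_addHaar volume, finrank_euclideanSpace_fin]
    exact hψ.congr_fun (fun r hr => (heq r hr).symm) measurableSet_Ioi
  rw [← ofReal_integral_eq_lintegral_ofReal hint
    (Filter.Eventually.of_forall fun x => hφ _ (norm_nonneg x)),
    integral_fun_norm_addHaar volume, finrank_euclideanSpace_fin]
  congr 1
  rw [nsmul_eq_mul, smul_eq_mul, mul_assoc]
  congr 2
  exact setIntegral_congr_fun measurableSet_Ioi heq

theorem integral_max_rpow {a ρ : ℝ} (ha : a < -1) (hρ : 0 < ρ) :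
    IntegrableOn (fun r => max r ρ ^ a) (Set.Ioi 0) ∧
      ∫ r in Set.Ioi (0 : ℝ), max r ρ ^ a = (1 - 1 / (a + 1)) * ρ ^ (a + 1) := by
  have e1 : Set.EqOn (fun r : ℝ => max r ρ ^ a) (fun _ => ρ ^ a) (Set.Ioc 0 ρ) :=
    fun r hr => by simp only [max_eq_right hr.2]
  have e2 : Set.EqOn (fun r : ℝ => max r ρ ^ a) (fun r => r ^ a) (Set.Ioi ρ) :=
    fun r hr => by simp only [max_eq_left (le_of_lt (Set.mem_Ioi.1 hr))]
  have h1 : IntegrableOn (fun r => max r ρ ^ a) (Set.Ioc 0 ρ) :=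
    (integrableOn_const (by simp)).congr_fun e1.symm measurableSet_Ioc
  have h2 : IntegrableOn (fun r => max r ρ ^ a) (Set.Ioi ρ) :=
    (integrableOn_Ioi_rpow_of_lt ha hρ).congr_fun e2.symm measurableSet_Ioi
  rw [← Set.Ioc_union_Ioi_eq_Ioi hρ.le]
  refine ⟨h1.union h2, ?_⟩
  rw [setIntegral_union (Set.Ioc_disjoint_Ioi le_rfl) measurableSet_Ioi h1 h2,
    setIntegral_congr_fun measurableSet_Ioc e1, setIntegral_congr_fun measurableSet_Ioi e2,
    integral_Ioi_rpow_of_lt ha hρ, setIntegral_const, Real.volume_real_Ioc_of_le hρ.le,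
    Real.rpow_add hρ, Real.rpow_one, smul_eq_mul]
  have : a + 1 ≠ 0 := by linarith
  field_simp
  ring

theorem rpow_mul_rpow_le_add {a b ρ s : ℝ} (ha : 0 ≤ a) (hb : 0 ≤ b) (hρ : 0 < ρ)
    (hab : 2 * ρ ≤ a + b) (hs : s ≤ 0) :
    a ^ s * b ^ s ≤ a ^ s * max a ρ ^ s + b ^ s * max b ρ ^ s := by
  rcases le_total a b with h | h
  · have : b ^ s ≤ max a ρ ^ s :=
      Real.rpow_le_rpow_of_nonpos (lt_max_of_lt_right hρ) (max_le h (by linarith)) hs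
    have : a ^ s * b ^ s ≤ a ^ s * max a ρ ^ s := by gcongr
    have : 0 ≤ b ^ s * max b ρ ^ s := by positivity
    linarith
  · have : a ^ s ≤ max b ρ ^ s :=
      Real.rpow_le_rpow_of_nonpos (lt_max_of_lt_right hρ) (max_le h (by linarith)) hs
    have : a ^ s * b ^ s ≤ b ^ s * max b ρ ^ s := by rw [mul_comm]; gcongr
    have : 0 ≤ a ^ s * max a ρ ^ s := by positivity
    linarith

theorem pow_pred_mul_rpow {d : ℕ} (hd : 1 ≤ d) {r : ℝ} (hr : 0 < r) (s : ℝ) :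
    r ^ (d - 1) * r ^ (s - d) = r ^ (s - 1) := by
  rw [← Real.rpow_natCast, ← Real.rpow_add hr, Nat.cast_sub hd]
  congr 1
  push_cast
  ring

/-- The Riesz kernel of order one composed with itself is dominated by the kernel of order two. -/
theorem exists_lintegral_riesz_mul_riesz_le {d : ℕ} (hd : 3 ≤ d) :
    ∃ C > (0 : ℝ), ∀ x z : EuclideanSpace ℝ (Fin d), x ≠ z →
      ∫⁻ y, ENNReal.ofReal (‖x - y‖ ^ ((1 : ℝ) - d)) * ENNReal.ofReal (‖y - z‖ ^ ((1 : ℝ) - d))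
        ≤ ENNReal.ofReal (C * ‖x - z‖ ^ ((2 : ℝ) - d)) := by
  have hd' : (3 : ℝ) ≤ d := by exact_mod_cast hd
  set ω := volume.real (Metric.ball (0 : EuclideanSpace ℝ (Fin d)) 1) with hω
  have hω0 : 0 ≤ ω := measureReal_nonneg
  set s : ℝ := 1 - d with hs
  set c : ℝ := d * ω * (1 - 1 / (s + 1)) with hc
  have hc0 : 0 ≤ c := by
    have : 1 / (s + 1) ≤ 0 := div_nonpos_of_nonneg_of_nonpos zero_le_one (by linarith)
    exact mul_nonneg (by positivity) (by linarith)
  refine ⟨2 * c * (1 / 2) ^ ((2 : ℝ) - d) + 1, by positivity, fun x z hxz => ?_⟩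
  set ρ := ‖x - z‖ * (1 / 2) with hρ
  have hxz0 : 0 < ‖x - z‖ := norm_pos_iff.2 (sub_ne_zero.2 hxz)
  have hρ0 : 0 < ρ := by positivity
  let φ : ℝ → ℝ := fun r => r ^ s * max r ρ ^ s
  have hφm : Measurable φ := by fun_prop
  have hφ0 : ∀ r, 0 ≤ r → 0 ≤ φ r := fun r hr => by positivity
  obtain ⟨hI, hIv⟩ := integral_max_rpow (a := s) (by linarith) hρ0
  have hφint : ∫⁻ y : EuclideanSpace ℝ (Fin d), ENNReal.ofReal (φ ‖y‖)
      = ENNReal.ofReal (c * ρ ^ (s + 1)) := by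
    rw [lintegral_ofReal_comp_norm hd hφ0 hI, hIv, hc, mul_assoc (d * ω)]
    intro r hr
    simp only [φ]
    rw [← mul_assoc, hs, pow_pred_mul_rpow (by omega) hr, sub_self, Real.rpow_zero, one_mul]
  calc ∫⁻ y, ENNReal.ofReal (‖x - y‖ ^ s) * ENNReal.ofReal (‖y - z‖ ^ s)
      ≤ ∫⁻ y, (ENNReal.ofReal (φ ‖x - y‖) + ENNReal.ofReal (φ ‖y - z‖)) := by
        refine lintegral_mono fun y => ?_
        rw [← ENNReal.ofReal_mul (by positivity),
          ← ENNReal.ofReal_add (hφ0 _ (norm_nonneg _)) (hφ0 _ (norm_nonneg _))]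
        refine ENNReal.ofReal_le_ofReal (rpow_mul_rpow_le_add (norm_nonneg _) (norm_nonneg _)
          hρ0 ?_ (by linarith))
        have := norm_sub_le_norm_sub_add_norm_sub x y z
        linarith
    _ = ENNReal.ofReal (c * ρ ^ (s + 1)) + ENNReal.ofReal (c * ρ ^ (s + 1)) := by
        rw [lintegral_add_left (by fun_prop),
          lintegral_sub_left_eq_self (fun y => ENNReal.ofReal (φ ‖y‖)) x,
          lintegral_sub_right_eq_self (fun y => ENNReal.ofReal (φ ‖y‖)) z, hφint]
    _ ≤ _ := by
        rw [← ENNReal.ofReal_add (by positivity) (by positivity)]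
        refine ENNReal.ofReal_le_ofReal ?_
        rw [show s + 1 = (2 : ℝ) - d by rw [hs]; ring, hρ,
          Real.mul_rpow hxz0.le (by norm_num)]
        have : 0 ≤ ‖x - z‖ ^ ((2 : ℝ) - d) := by positivity
        linarith

theorem setLIntegral_norm_sub_rpow_le {d : ℕ} (hd : 3 ≤ d) {B : Set (EuclideanSpace ℝ (Fin d))}
    (hB0 : volume B ≠ 0) (hB : volume B ≠ ∞) (x : EuclideanSpace ℝ (Fin d)) :
    ∫⁻ z in B, ENNReal.ofReal (‖x - z‖ ^ ((2 : ℝ) - d))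
      ≤ ENNReal.ofReal (d * volume.real (Metric.ball (0 : EuclideanSpace ℝ (Fin d)) 1) / 2 + 1)
        * volume B ^ ((2 : ℝ) / d) := by
  have hd' : (3 : ℝ) ≤ d := by exact_mod_cast hd
  set ω := volume.real (Metric.ball (0 : EuclideanSpace ℝ (Fin d)) 1) with hω
  have hω0 : 0 ≤ ω := measureReal_nonneg
  set m := (volume B).toReal with hm
  have hmpos : 0 < m := ENNReal.toReal_pos hB0 hB
  have hmB : volume B = ENNReal.ofReal m := (ENNReal.ofReal_toReal hB).symm
  set R := m ^ ((1 : ℝ) / d) with hR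
  have hR0 : 0 < R := by positivity
  let φ : ℝ → ℝ := (Set.Iic R).indicator fun r => r ^ ((2 : ℝ) - d)
  have hφm : Measurable φ := Measurable.indicator (by fun_prop) measurableSet_Iic
  have hφ0 : ∀ r, 0 ≤ r → 0 ≤ φ r := fun r hr =>
    Set.indicator_apply_nonneg fun _ => by positivity
  have hψint : IntegrableOn (fun r : ℝ => r) (Set.Ioc 0 R) :=
    (continuous_id.integrableOn_Icc).mono_set Set.Ioc_subset_Icc_self
  have hψ : IntegrableOn ((Set.Iic R).indicator fun r : ℝ => r) (Set.Ioi 0) := by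
    rw [IntegrableOn, integrable_indicator_iff measurableSet_Iic, IntegrableOn,
      Measure.restrict_restrict measurableSet_Iic, Set.Iic_inter_Ioi]
    exact hψint
  have hψv : ∫ r in Set.Ioi (0 : ℝ), (Set.Iic R).indicator (fun r : ℝ => r) r = R ^ 2 / 2 := by
    rw [setIntegral_indicator measurableSet_Iic, Set.Ioi_inter_Iic,
      ← intervalIntegral.integral_of_le hR0.le, integral_id]
    ring
  have hφint : ∫⁻ y : EuclideanSpace ℝ (Fin d), ENNReal.ofReal (φ ‖y‖)
      = ENNReal.ofReal (d * ω * (R ^ 2 / 2)) := by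
    rw [lintegral_ofReal_comp_norm hd hφ0 hψ, hψv]
    intro r hr
    simp only [φ, Set.indicator_apply]
    split_ifs
    · rw [pow_pred_mul_rpow (by omega) hr, show (2 : ℝ) - 1 = 1 by norm_num, Real.rpow_one]
    · simp
  have hRm : R ^ ((2 : ℝ) - d) * m = R ^ 2 := by
    have : m = R ^ (d : ℝ) := by
      rw [hR, ← Real.rpow_mul hmpos.le, one_div_mul_cancel (by positivity), Real.rpow_one]
    rw [this, ← Real.rpow_add hR0, sub_add_cancel, Real.rpow_two]
  have hR2 : R ^ 2 = m ^ ((2 : ℝ) / d) := by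
    rw [hR, ← Real.rpow_two, ← Real.rpow_mul hmpos.le]
    congr 1
    ring
  calc ∫⁻ z in B, ENNReal.ofReal (‖x - z‖ ^ ((2 : ℝ) - d))
      ≤ ∫⁻ z in B, (ENNReal.ofReal (φ ‖x - z‖) + ENNReal.ofReal (R ^ ((2 : ℝ) - d))) := by
        refine lintegral_mono fun z => ?_
        rw [← ENNReal.ofReal_add (hφ0 _ (norm_nonneg _)) (by positivity)]
        refine ENNReal.ofReal_le_ofReal ?_
        simp only [φ, Set.indicator_apply, Set.mem_Iic]
        split_ifs with h
        · have : 0 ≤ R ^ ((2 : ℝ) - d) := by positivity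
          linarith
        · rw [zero_add]
          exact Real.rpow_le_rpow_of_nonpos hR0 (not_le.1 h).le (by linarith)
    _ ≤ ENNReal.ofReal (d * ω * (R ^ 2 / 2)) + ENNReal.ofReal (R ^ ((2 : ℝ) - d)) * volume B := by
        rw [lintegral_add_left (by fun_prop), setLIntegral_const]
        gcongr
        rw [← hφint, ← lintegral_sub_left_eq_self (fun y => ENNReal.ofReal (φ ‖y‖)) x]
        exact setLIntegral_le_lintegral _ _
    _ = _ := by
        rw [hmB, ← ENNReal.ofReal_mul (by positivity), hRm, ENNReal.ofReal_rpow_of_pos hmpos, ← hR2,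
          ← ENNReal.ofReal_add (by positivity) (by positivity),
          ← ENNReal.ofReal_mul (by positivity)]
        congr 1
        ring

theorem exists_setLIntegral_riesz_mul_riesz_le {d : ℕ} (hd : 3 ≤ d) :
    ∃ K > (0 : ℝ), ∀ B : Set (EuclideanSpace ℝ (Fin d)), ∀ x,
      ∫⁻ z in B, ∫⁻ y, ENNReal.ofReal (‖x - y‖ ^ ((1 : ℝ) - d))
          * ENNReal.ofReal (‖y - z‖ ^ ((1 : ℝ) - d))
        ≤ ENNReal.ofReal K * volume B ^ ((2 : ℝ) / d) := by
  obtain ⟨C, hC, hle⟩ := exists_lintegral_riesz_mul_riesz_le hd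
  have hd0 : (0 : ℝ) < d := by positivity
  have : Nontrivial (EuclideanSpace ℝ (Fin d)) :=
    Module.nontrivial_of_finrank_pos (R := ℝ) (by rw [finrank_euclideanSpace_fin]; omega)
  set ω := volume.real (Metric.ball (0 : EuclideanSpace ℝ (Fin d)) 1) with hω
  have hω0 : 0 ≤ ω := measureReal_nonneg
  refine ⟨C * (d * ω / 2 + 1), by positivity, fun B x => ?_⟩
  rcases eq_or_ne (volume B) 0 with hB0 | hB0
  · rw [Measure.restrict_eq_zero.2 hB0]; simp
  rcases eq_or_ne (volume B) ∞ with hB | hB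
  · rw [hB, ENNReal.top_rpow_of_pos (by positivity), ENNReal.mul_top]
    · exact le_top
    · exact (ENNReal.ofReal_pos.2 (by positivity)).ne'
  calc ∫⁻ z in B, ∫⁻ y, ENNReal.ofReal (‖x - y‖ ^ ((1 : ℝ) - d))
          * ENNReal.ofReal (‖y - z‖ ^ ((1 : ℝ) - d))
      ≤ ∫⁻ z in B, ENNReal.ofReal C * ENNReal.ofReal (‖x - z‖ ^ ((2 : ℝ) - d)) := by
        refine lintegral_mono_ae (ae_restrict_of_ae ?_)
        filter_upwards [Measure.ae_ne volume x] with z hz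
        rw [← ENNReal.ofReal_mul hC.le]
        exact hle x z hz.symm
    _ ≤ _ := by
        rw [lintegral_const_mul _ (by fun_prop), ENNReal.ofReal_mul hC.le, mul_assoc]
        gcongr
        exact setLIntegral_norm_sub_rpow_le hd hB0 hB x

/-- Strichartz-type bound: if `V ∈ L^{d/2,∞}(ℝ^d)` (weak norm at most `M`), then
`‖ |V|^{1/2} (-Δ)^{-1/2} f ‖₂² ≤ C_d M ‖f‖₂²`, where `(-Δ)^{-1/2}` is the Riesz
potential with kernel `c₁ |x-y|^{1-d}`. -/
theorem strichartz_weak_Ld2_bound (d : ℕ) (hd : 3 ≤ d) (c₁ : ℝ) :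
    ∃ C > (0 : ℝ), ∀ (V : EuclideanSpace ℝ (Fin d) → ℝ), Measurable V →
      ∀ (M : ℝ), 0 ≤ M →
      (∀ l : ℝ, 0 < l →
        ENNReal.ofReal l * (volume {x | l < |V x|}) ^ ((2 : ℝ) / d) ≤ ENNReal.ofReal M) →
      ∀ (f : EuclideanSpace ℝ (Fin d) → ℝ), Measurable f →
        ∫⁻ x, ENNReal.ofReal (|V x| *
            (∫ y, c₁ * ‖x - y‖ ^ ((1 : ℝ) - d) * f y) ^ 2) ≤
          ENNReal.ofReal (C * M) * ∫⁻ x, ENNReal.ofReal ((f x) ^ 2) := by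
  obtain ⟨K, hK0, hK⟩ := exists_setLIntegral_riesz_mul_riesz_le hd
  have hd' : (3 : ℝ) ≤ d := by exact_mod_cast hd
  have hα0 : (0 : ℝ) < 2 / d := by positivity
  have hα1 : (2 : ℝ) / d < 1 := by rw [div_lt_one (by positivity)]; linarith
  have hα1' : 0 < 1 - (2 : ℝ) / d := by linarith
  refine ⟨c₁ ^ 2 * (16 * K / (1 - 2 / d)) + 1, by positivity, fun V hV M hM hVM f hf => ?_⟩
  have hmain := lintegral_weak_mul_potential_sq_le (μ := volume)
    (k := fun x y : EuclideanSpace ℝ (Fin d) => ENNReal.ofReal (‖x - y‖ ^ ((1 : ℝ) - d)))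
    (by unfold Function.uncurry; fun_prop) (fun x y => by rw [norm_sub_rev]) hα0 hα1
    (fun B _ x => hK B x) (W := fun x => |V x|) (by fun_prop) (fun x => abs_nonneg _) hM hVM
    (f := fun y => ‖f y‖ₑ) (by fun_prop)
  have hpt : ∀ x, ENNReal.ofReal (|V x| * (∫ y, c₁ * ‖x - y‖ ^ ((1 : ℝ) - d) * f y) ^ 2)
      ≤ ENNReal.ofReal (c₁ ^ 2) * (ENNReal.ofReal |V x|
        * (∫⁻ y, ENNReal.ofReal (‖x - y‖ ^ ((1 : ℝ) - d)) * ‖f y‖ₑ) ^ 2) := by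
    intro x
    have hI : ‖∫ y, c₁ * ‖x - y‖ ^ ((1 : ℝ) - d) * f y‖ₑ
        ≤ ‖c₁‖ₑ * ∫⁻ y, ENNReal.ofReal (‖x - y‖ ^ ((1 : ℝ) - d)) * ‖f y‖ₑ := by
      refine (enorm_integral_le_lintegral_enorm _).trans_eq ?_
      rw [← lintegral_const_mul _ (by fun_prop)]
      refine lintegral_congr fun y => ?_
      rw [enorm_mul, enorm_mul, mul_assoc, Real.enorm_of_nonneg (r := ‖x - y‖ ^ _) (by positivity)]
    have hsq : ∀ t : ℝ, ENNReal.ofReal (t ^ 2) = ‖t‖ₑ ^ 2 := fun t => by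
      rw [← sq_abs, ENNReal.ofReal_pow (abs_nonneg t), ← Real.enorm_eq_ofReal_abs]
    rw [ENNReal.ofReal_mul (abs_nonneg _), hsq, hsq, mul_left_comm, ← mul_pow]
    gcongr
  calc ∫⁻ x, ENNReal.ofReal (|V x| * (∫ y, c₁ * ‖x - y‖ ^ ((1 : ℝ) - d) * f y) ^ 2)
      ≤ ENNReal.ofReal (c₁ ^ 2) * ∫⁻ x, ENNReal.ofReal |V x|
        * (∫⁻ y, ENNReal.ofReal (‖x - y‖ ^ ((1 : ℝ) - d)) * ‖f y‖ₑ) ^ 2 := by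
        rw [← lintegral_const_mul' _ _ ENNReal.ofReal_ne_top]
        exact lintegral_mono hpt
    _ ≤ ENNReal.ofReal (c₁ ^ 2) * (16 * ENNReal.ofReal K * ENNReal.ofReal (M / (1 - 2 / d))
        * ∫⁻ x, ‖f x‖ₑ ^ (2 : ℝ)) := by gcongr
    _ = ENNReal.ofReal (c₁ ^ 2 * (16 * K / (1 - 2 / d)) * M)
        * ∫⁻ x, ENNReal.ofReal ((f x) ^ 2) := by
        have h16 : (16 : ℝ≥0∞) = ENNReal.ofReal 16 := by norm_num
        rw [h16, ← mul_assoc, ← ENNReal.ofReal_mul (by norm_num),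
          ← ENNReal.ofReal_mul (by positivity), ← ENNReal.ofReal_mul (by positivity)]
        congr 1
        · congr 1; ring
        · refine lintegral_congr fun x => ?_
          rw [ENNReal.rpow_two, ← sq_abs, ENNReal.ofReal_pow (abs_nonneg _),
            ← Real.enorm_eq_ofReal_abs]
    _ ≤ _ := by
        gcongr
        linarith
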